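/- Let (G, p, L) be a minimum counterexample, minimizing the number of vertices and edges of G, to the following statement: 'Every plane graph G with no 5-cycle and no 6-cycle, with p ∈ V(G) and L a (*,1)-list assignment with |L(p)| = 1 and |L(v)| = 3 for all v ≠ p, is L-colorable.' Then G contains no 3-face incident to at most one high vertex; that is, G has no triangular face xyz in which two of the three incident vertices have degree exactly 3. -/

import Mathlib

open Set

namespace ChoosSep

/-- `G` has a cycle of length `n`. -/
def HasCycleLen {V : Type} (G : SimpleGraph V) (n : ℕ) : Prop :=
  ∃ (v : V) (c : G.Walk v v), c.IsCycle ∧ c.length = n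

/-- `G` has a proper coloring choosing each color from the list `L v`. -/
def ColorableWith {V : Type} (G : SimpleGraph V) (L : V → Finset ℕ) : Prop :=
  ∃ φ : V → ℕ, (∀ v, φ v ∈ L v) ∧ ∀ ⦃u v⦄, G.Adj u v → φ u ≠ φ v

/-- `G` is `(k,d)`-choosable: it has an `L`-coloring for every list assignment
giving each vertex at least `k` colors and any two adjacent vertices at most `d`
common colors. -/
def Choosable {V : Type} (G : SimpleGraph V) (k d : ℕ) : Prop :=
  ∀ L : V → Finset ℕ, (∀ v, k ≤ (L v).card) →
    (∀ ⦃u v⦄, G.Adj u v → ((L u) ∩ (L v)).card ≤ d) →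
    ColorableWith G L

/-- The closed straight segment between two points of the plane. -/
def seg (x y : ℝ × ℝ) : Set (ℝ × ℝ) := segment ℝ x y

/-- A straight-line plane embedding of `G`: vertices go to distinct points, edges are
drawn as straight segments, two distinct edges meet only in common endpoints, and no
vertex lies on the drawing of an edge it does not belong to.  By Fáry's theorem a
finite simple graph admits such an embedding iff it is planar. -/
structure PlaneEmb {V : Type} (G : SimpleGraph V) where
  pos : V → ℝ × ℝ
  inj : Function.Injective pos
  edges_meet : ∀ ⦃a b c d : V⦄, G.Adj a b → G.Adj c d → s(a, b) ≠ s(c, d) →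
    seg (pos a) (pos b) ∩ seg (pos c) (pos d) ⊆ ({pos a, pos b} ∩ {pos c, pos d} : Set (ℝ × ℝ))
  vertex_off : ∀ ⦃a b v : V⦄, G.Adj a b → v ≠ a → v ≠ b → pos v ∉ seg (pos a) (pos b)

/-- `G` is planar: it admits a plane embedding. -/
def IsPlanar {V : Type} (G : SimpleGraph V) : Prop := Nonempty (PlaneEmb G)

variable {V : Type} {G : SimpleGraph V}

/-- The drawing of the graph in the plane: all vertex points and all edge segments. -/
def PlaneEmb.drawing (E : PlaneEmb G) : Set (ℝ × ℝ) :=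
  Set.range E.pos ∪ ⋃ (a : V) (b : V) (_ : G.Adj a b), seg (E.pos a) (E.pos b)

/-- A face of the embedding: a connected component of the complement of the drawing. -/
def PlaneEmb.IsFace (E : PlaneEmb G) (C : Set (ℝ × ℝ)) : Prop :=
  ∃ q, q ∉ E.drawing ∧ C = connectedComponentIn E.drawingᶜ q

/-- The outer face: the unbounded face. -/
def PlaneEmb.IsOuterFace (E : PlaneEmb G) (C : Set (ℝ × ℝ)) : Prop :=
  E.IsFace C ∧ ¬ Bornology.IsBounded C

/-- The vertices lying on the boundary of the face `C`. -/
def PlaneEmb.onFace (E : PlaneEmb G) (C : Set (ℝ × ℝ)) : Set V :=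
  {v | E.pos v ∈ closure C}

/-- An edge of `G` lying on the boundary of the face `C`. -/
def PlaneEmb.BoundaryEdge (E : PlaneEmb G) (C : Set (ℝ × ℝ)) (u v : V) : Prop :=
  G.Adj u v ∧ seg (E.pos u) (E.pos v) ⊆ closure C

/-- `C` is a 3-face with (mutually adjacent) incident vertices `x`, `y`, `z`. -/
def PlaneEmb.IsTriFace (E : PlaneEmb G) (C : Set (ℝ × ℝ)) (x y z : V) : Prop :=
  E.IsFace C ∧ G.Adj x y ∧ G.Adj y z ∧ G.Adj x z ∧
    frontier C = seg (E.pos x) (E.pos y) ∪ seg (E.pos y) (E.pos z) ∪ seg (E.pos x) (E.pos z)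

/-- `C` is a 4-face with incident 4-cycle `w x y z`. -/
def PlaneEmb.IsQuadFace (E : PlaneEmb G) (C : Set (ℝ × ℝ)) (w x y z : V) : Prop :=
  E.IsFace C ∧ G.Adj w x ∧ G.Adj x y ∧ G.Adj y z ∧ G.Adj z w ∧ w ≠ y ∧ x ≠ z ∧
    frontier C = seg (E.pos w) (E.pos x) ∪ seg (E.pos x) (E.pos y) ∪
      seg (E.pos y) (E.pos z) ∪ seg (E.pos z) (E.pos w)

/-- `x z1 y z2` is a diamond: a 4-cycle formed by two adjacent 3-faces
`x y z1` and `x y z2` sharing the edge `x y`. -/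
def PlaneEmb.IsDiamond (E : PlaneEmb G) (x z1 y z2 : V) : Prop :=
  z1 ≠ z2 ∧ ∃ C1 C2 : Set (ℝ × ℝ), C1 ≠ C2 ∧ E.IsTriFace C1 x y z1 ∧ E.IsTriFace C2 x y z2

/-- The union of the three sides of the triangle `a b c`. -/
def triBoundary (a b c : ℝ × ℝ) : Set (ℝ × ℝ) := seg a b ∪ seg b c ∪ seg a c

/-- The open interior region of the triangle `a b c`: points off the triangle whose
connected component in the complement of the triangle is bounded. -/
def triInterior (a b c : ℝ × ℝ) : Set (ℝ × ℝ) :=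
  {p | p ∉ triBoundary a b c ∧
    Bornology.IsBounded (connectedComponentIn (triBoundary a b c)ᶜ p)}

/-- The degree of a vertex. -/
noncomputable def deg (G : SimpleGraph V) (v : V) : ℕ := Nat.card {u : V // G.Adj v u}

/-- `G` is 2-connected: connected and with no cutvertex. -/
def TwoConnected (G : SimpleGraph V) : Prop :=
  G.Connected ∧ ∀ v : V, (G.induce {u : V | u ≠ v}).Connected

/-- A configuration for Theorem 8: a plane graph with no 5-cycle and no 6-cycle, a
vertex `p`, and a `(*,1)`-list assignment with `|L(p)| = 1` and `|L(v)| = 3`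
for every other vertex. -/
structure Cfg56 where
  n : ℕ
  G : SimpleGraph (Fin n)
  E : PlaneEmb G
  p : Fin n
  L : Fin n → Finset ℕ

namespace Cfg56

/-- All hypotheses of Theorem 8 hold for the configuration. -/
def Valid (C : Cfg56) : Prop :=
  (¬ HasCycleLen C.G 5) ∧ (¬ HasCycleLen C.G 6) ∧
  (∀ ⦃u v⦄, C.G.Adj u v → ((C.L u) ∩ (C.L v)).card ≤ 1) ∧
  (C.L C.p).card = 1 ∧
  (∀ v, v ≠ C.p → (C.L v).card = 3)

/-- The configuration admits an `L`-coloring. -/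
def Colorable (C : Cfg56) : Prop := ColorableWith C.G C.L

/-- The quantity `|V(G)| + |E(G)|`. -/
noncomputable def measure (C : Cfg56) : ℕ := C.n + Nat.card ↥C.G.edgeSet

/-- `C` is a minimum counterexample to Theorem 8: it satisfies the hypotheses, has no
`L`-coloring, and minimizes `|V(G)| + |E(G)|` among all such counterexamples. -/
def MinCounterexample (C : Cfg56) : Prop :=
  C.Valid ∧ ¬ C.Colorable ∧
    ∀ D : Cfg56, D.Valid → ¬ D.Colorable → C.measure ≤ D.measure

end Cfg56

/-- A plane embedding restricts to any subgraph on the same vertex set. -/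
def PlaneEmb.restrict {H : SimpleGraph V} (E : PlaneEmb G) (h : H ≤ G) : PlaneEmb H where
  pos := E.pos
  inj := E.inj
  edges_meet := fun _ _ _ _ hab hcd => E.edges_meet (h hab) (h hcd)
  vertex_off := fun _ _ _ hab => E.vertex_off (h hab)

theorem HasCycleLen.mono {H : SimpleGraph V} (h : H ≤ G) {n : ℕ} (hc : HasCycleLen H n) :
    HasCycleLen G n := by
  obtain ⟨v, c, hcyc, hlen⟩ := hc
  exact ⟨v, c.mapLe h, hcyc.mapLe h, by simpa using hlen⟩

namespace Cfg56

/-- Every proper spanning subgraph of a minimum counterexample is colorable. -/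
theorem MinCounterexample.colorableWith_of_lt {C : Cfg56} (hC : C.MinCounterexample)
    {H : SimpleGraph (Fin C.n)} (h : H < C.G) : ColorableWith H C.L := by
  obtain ⟨⟨h5, h6, hL, hp, hv⟩, -, hmin⟩ := hC
  by_contra hcol
  have hle := hmin ⟨C.n, H, C.E.restrict h.le, C.p, C.L⟩
    ⟨fun h' => h5 (h'.mono h.le), fun h' => h6 (h'.mono h.le),
      fun _ _ huv => hL (h.le huv), hp, hv⟩ hcol
  have hlt : H.edgeSet.ncard < C.G.edgeSet.ncard :=
    Set.ncard_lt_ncard (SimpleGraph.edgeSet_ssubset_edgeSet.2 h) (Set.toFinite _)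
  simp only [measure, Nat.card_coe_set_eq] at hle
  omega

/-- In a minimum counterexample, every coloring proper off the edge `uv` gives `u` and `v`
the same color. -/
theorem MinCounterexample.exists_coloring_eq {C : Cfg56} (hC : C.MinCounterexample)
    {u v : Fin C.n} (huv : C.G.Adj u v) :
    ∃ φ : Fin C.n → ℕ, (∀ w, φ w ∈ C.L w) ∧ φ u = φ v ∧
      ∀ ⦃a b⦄, C.G.Adj a b → s(a, b) ≠ s(u, v) → φ a ≠ φ b := by
  obtain ⟨φ, hφ, hprop⟩ := hC.colorableWith_of_lt (H := C.G.deleteEdges {s(u, v)})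
    (lt_of_le_of_ne (SimpleGraph.deleteEdges_le _) fun h => by
      have := h ▸ huv
      simp at this)
  have hprop' : ∀ ⦃a b⦄, C.G.Adj a b → s(a, b) ≠ s(u, v) → φ a ≠ φ b := fun a b hab hne =>
    hprop (by rw [SimpleGraph.deleteEdges_adj]; exact ⟨hab, hne⟩)
  refine ⟨φ, hφ, ?_, hprop'⟩
  by_contra hne
  refine hC.2.1 ⟨φ, hφ, fun a b hab => ?_⟩
  by_cases h : s(a, b) = s(u, v)
  · rcases Sym2.eq_iff.1 h with ⟨rfl, rfl⟩ | ⟨rfl, rfl⟩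
    exacts [hne, Ne.symm hne]
  · exact hprop' hab h

/-- In a minimum counterexample, the precolored vertex lies in no triangle. -/
theorem MinCounterexample.not_triangle_precolored {C : Cfg56} (hC : C.MinCounterexample)
    {y z : Fin C.n} (hpy : C.G.Adj C.p y) (hyz : C.G.Adj y z) (hpz : C.G.Adj C.p z) : False := by
  obtain ⟨a, ha⟩ := Finset.card_eq_one.1 hC.1.2.2.2.1
  have mem_of_adj : ∀ {v}, C.G.Adj C.p v → a ∈ C.L v := by
    intro v hv
    obtain ⟨φ, hφ, heq, -⟩ := hC.exists_coloring_eq hv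
    have hpa : φ C.p = a := by simpa [ha] using hφ C.p
    exact hpa ▸ heq ▸ hφ v
  obtain ⟨φ, hφ, heq, hprop⟩ := hC.exists_coloring_eq hyz
  have hpa : φ C.p = a := by simpa [ha] using hφ C.p
  have hya : φ C.p ≠ φ y := hprop hpy (by simp [hpy.ne, hpz.ne])
  have hcommon := Finset.card_le_one.1 (hC.1.2.2.1 hyz)
  exact hya (hpa.trans (hcommon a (by simp [mem_of_adj hpy, mem_of_adj hpz]) (φ y)
    (by simp [hφ y, heq ▸ hφ z])))

end Cfg56

/-- A degree-3 vertex `x` with a list of three colors and adjacent to an uncolored `y` keeps an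
available color; it keeps two unless the color of a given further neighbor `z` is in its list. -/
theorem exists_available [Finite V] {L : V → Finset ℕ}
    {x y z : V} (φ : V → ℕ) (hL : (L x).card = 3) (hd : deg G x = 3)
    (hxy : G.Adj x y) (hxz : G.Adj x z) (hyz : y ≠ z) :
    ∃ A ⊆ L x, A.Nonempty ∧ (φ z ∉ L x → 2 ≤ A.card) ∧
      ∀ c ∈ A, ∀ v, G.Adj x v → v ≠ y → c ≠ φ v := by
  classical
  have := Fintype.ofFinite V
  have hdeg : (G.neighborFinset x).card = 3 := by
    rw [← hd, deg, SimpleGraph.card_neighborFinset_eq_degree,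
      ← SimpleGraph.card_neighborSet_eq_degree, Nat.card_eq_fintype_card]
    rfl
  set N := (G.neighborFinset x).erase y with hN
  have hNcard : N.card = 2 := by
    rw [hN, Finset.card_erase_of_mem (by simpa using hxy), hdeg]
  have hzN : z ∈ N := by simp [hN, hxz, hyz.symm]
  have himg : (N.image φ).card ≤ 2 := Finset.card_image_le.trans hNcard.le
  refine ⟨L x \ N.image φ, Finset.sdiff_subset, ?_, fun hz => ?_, fun c hc v hv hvy h => ?_⟩
  · have := Finset.le_card_sdiff (N.image φ) (L x)
    exact Finset.card_pos.1 (by omega)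
  · have heq : L x \ N.image φ = L x \ (N.image φ).erase (φ z) := by
      ext c
      simp only [Finset.mem_sdiff, Finset.mem_erase]
      constructor
      · exact fun h => ⟨h.1, fun h' => h.2 h'.2⟩
      · exact fun h => ⟨h.1, fun h' => h.2 ⟨fun e => hz (e ▸ h.1), h'⟩⟩
    have h1 := Finset.le_card_sdiff ((N.image φ).erase (φ z)) (L x)
    rw [Finset.card_erase_of_mem (Finset.mem_image_of_mem φ hzN)] at h1
    rw [heq]
    omega
  · exact (Finset.mem_sdiff.1 hc).2 (Finset.mem_image.2 ⟨v, by simp [hN, hv, hvy], h.symm⟩)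

/-- Two nonempty available sets admit distinct choices unless both are the same singleton. -/
theorem exists_ne_of_two_le_card {A B : Finset ℕ} (hA : A.Nonempty) (hB : B.Nonempty)
    (h : A = B → 2 ≤ A.card) : ∃ c ∈ A, ∃ d ∈ B, c ≠ d := by
  by_contra! hall
  obtain ⟨c, hc⟩ := hA
  obtain ⟨d, hd⟩ := hB
  have hA : A = {d} := Finset.eq_singleton_iff_unique_mem.2
    ⟨hall c hc d hd ▸ hc, fun e he => hall e he d hd⟩
  have hB : B = {c} := Finset.eq_singleton_iff_unique_mem.2
    ⟨hall c hc d hd ▸ hd, fun e he => (hall c hc e he).symm⟩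
  have hcd := hall c hc d hd
  subst hcd
  have := h (hA.trans hB.symm)
  simp [hA] at this

/-- In a minimum counterexample, no triangle contains two vertices of degree 3. -/
theorem Cfg56.MinCounterexample.not_triangle_two_low {C : Cfg56} (hC : C.MinCounterexample)
    {x y z : Fin C.n} (hxy : C.G.Adj x y) (hyz : C.G.Adj y z) (hxz : C.G.Adj x z)
    (hdx : deg C.G x = 3) (hdy : deg C.G y = 3) : False := by
  have hxp : x ≠ C.p := by
    rintro rfl
    exact hC.not_triangle_precolored hxy hyz hxz
  have hyp : y ≠ C.p := by
    rintro rfl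
    exact hC.not_triangle_precolored hxy.symm hxz hyz
  obtain ⟨-, -, hsep, -, hcard⟩ := hC.1
  obtain ⟨φ, hφ, hprop⟩ := hC.colorableWith_of_lt
    (H := C.G.deleteEdges {e | x ∈ e ∨ y ∈ e})
    (lt_of_le_of_ne (SimpleGraph.deleteEdges_le _) fun h => by
      have := h ▸ hxy
      simp at this)
  have hprop' : ∀ ⦃u v⦄, C.G.Adj u v → u ≠ x → u ≠ y → v ≠ x → v ≠ y → φ u ≠ φ v := by
    intro u v huv h1 h2 h3 h4
    refine hprop ?_
    simp [SimpleGraph.deleteEdges_adj, huv, h1.symm, h2.symm, h3.symm, h4.symm]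
  obtain ⟨A, hAL, hA, hA2, hAφ⟩ :=
    exists_available φ (hcard x hxp) hdx hxy hxz hyz.ne
  obtain ⟨B, hBL, hB, hB2, hBφ⟩ :=
    exists_available φ (hcard y hyp) hdy hxy.symm hyz hxz.ne
  obtain ⟨c, hc, d, hd, hcd⟩ : ∃ c ∈ A, ∃ d ∈ B, c ≠ d := by
    refine exists_ne_of_two_le_card hA hB fun hAB => ?_
    by_contra hlt
    have hzx : φ z ∈ C.L x := by
      by_contra h
      exact hlt (hA2 h)
    have hzy : φ z ∈ C.L y := by
      by_contra h
      exact hlt (hAB ▸ hB2 h)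
    obtain ⟨c, hc⟩ := hA
    exact hAφ c hc z hxz hyz.ne.symm (Finset.card_le_one.1 (hsep hxy) c
      (Finset.mem_inter.2 ⟨hAL hc, hBL (hAB ▸ hc)⟩) _ (Finset.mem_inter.2 ⟨hzx, hzy⟩))
  refine hC.2.1 ⟨fun v => if v = x then c else if v = y then d else φ v, fun v => ?_, ?_⟩
  · dsimp only
    split_ifs with h1 h2
    · exact h1 ▸ hAL hc
    · exact h2 ▸ hBL hd
    · exact hφ v
  · intro u v huv
    dsimp only
    split_ifs with h1 h2 h3 h4 h5 h6 h7 h8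
    · exact absurd (h1.trans h2.symm) huv.ne
    · exact hcd
    · exact hAφ c hc v (h1 ▸ huv) h3
    · exact hcd.symm
    · exact absurd (h4.trans h6.symm) huv.ne
    · exact hBφ d hd v (h4 ▸ huv) h5
    · exact (hAφ c hc u (h7 ▸ huv.symm) h4).symm
    · exact (hBφ d hd u (h8 ▸ huv.symm) h1).symm
    · exact hprop' huv h1 h4 h7 h8

/-- **Configuration (C3) is reducible.** A minimum counterexample to Theorem 8 has no
3-face incident to at most one high vertex, i.e. no triangular face two of whose
incident vertices have degree exactly 3. -/
theorem min_cex_C5C6free_no_triface_two_low (C : Cfg56) (hC : C.MinCounterexample) :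
    ¬ ∃ (A : Set (ℝ × ℝ)) (x y z : Fin C.n), C.E.IsTriFace A x y z ∧
      ((deg C.G x = 3 ∧ deg C.G y = 3) ∨ (deg C.G y = 3 ∧ deg C.G z = 3) ∨
        (deg C.G x = 3 ∧ deg C.G z = 3)) := by
  rintro ⟨A, x, y, z, ⟨-, hxy, hyz, hxz, -⟩, ⟨hx, hy⟩ | ⟨hy, hz⟩ | ⟨hx, hz⟩⟩
  · exact hC.not_triangle_two_low hxy hyz hxz hx hy
  · exact hC.not_triangle_two_low hyz hxz.symm hxy.symm hy hz
  · exact hC.not_triangle_two_low hxz hyz.symm hxy hx hz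

end ChoosSep
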